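/- For every natural number n with n ≡ 2 (mod 4), the group cohomology H^n(Σ₃; ℤ) is isomorphic to ℤ/2ℤ. -/

import Mathlib

open CategoryTheory Matrix

lemma Rep.exact_of_forall_exists {k G : Type} [CommRing k] [Group G]
    (S : ShortComplex (Rep.{0} k G)) (h : ∀ x, S.g.hom x = 0 → ∃ y, S.f.hom y = x) : S.Exact := by
  apply (forget₂ (Rep.{0} k G) (ModuleCat k)).reflects_exact_of_faithful
  rw [ShortComplex.moduleCat_exact_iff]
  exact h

/-- The homology of a short complex of modules is any quotient of the cycles by a map whose kernel
consists of the boundaries. -/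
noncomputable def CategoryTheory.ShortComplex.homologyEquivOfSurjective {R : Type*} [Ring R]
    (S : ShortComplex (ModuleCat R)) {N : Type*} [AddCommGroup N] [Module R N]
    (φ : LinearMap.ker S.g.hom →ₗ[R] N) (hφ : Function.Surjective φ)
    (h : ∀ x, φ x = 0 ↔ ∃ w, S.moduleCatToCycles w = x) : S.homology ≃ₗ[R] N :=
  S.moduleCatHomologyIso.toLinearEquiv.trans <|
    (Submodule.quotEquivOfEq _ _ (Submodule.ext fun x => (h x).symm)).trans
      (φ.quotKerEquivOfSurjective hφ)

section FreeMaps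

variable {G ι κ : Type} [Group G] [Fintype G] [DecidableEq G] [Fintype ι] [DecidableEq ι]
  [Fintype κ] [DecidableEq κ]

/-- Coordinates on the free `ℤ[G]`-module on a finite type `ι`. -/
noncomputable def freeCoords (G ι : Type) [Group G] [Fintype G] [Fintype ι] :
    (ι →₀ MonoidAlgebra ℤ G) ≃ₗ[ℤ] (ι × G → ℤ) :=
  (Finsupp.linearEquivFunOnFinite ℤ _ ι).trans <|
    (LinearEquiv.piCongrRight fun _ => (MonoidAlgebra.coeffLinearEquiv ℤ).trans
      (Finsupp.linearEquivFunOnFinite ℤ ℤ G)).trans (LinearEquiv.curry ℤ ℤ ι G).symm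

omit [DecidableEq G] [DecidableEq ι] in
lemma freeCoords_apply (v : ι →₀ MonoidAlgebra ℤ G) (x : ι × G) :
    freeCoords G ι v x = (v x.1).coeff x.2 := rfl

/-- The map of free `ℤ[G]`-modules whose value on the basis vector `a` has coordinates `c a`. -/
noncomputable def freeMap (c : ι → κ → G → ℤ) : Rep.free ℤ G ι ⟶ Rep.free ℤ G κ :=
  Rep.freeLift ℤ G _ fun a => (freeCoords G κ).symm fun x => c a x.1 x.2

/-- The integral matrix of `freeMap c`, acting on row vectors. -/
def freeMatrix (c : ι → κ → G → ℤ) : Matrix (ι × G) (κ × G) ℤ :=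
  Matrix.of fun x y => c x.1 y.1 (x.2⁻¹ * y.2)

lemma freeCoords_single (a : ι) (g : G) :
    freeCoords G ι (Finsupp.single a (.single g 1)) = Pi.single (a, g) 1 := by
  ext ⟨b, h⟩
  rw [freeCoords_apply]
  by_cases hb : a = b <;> by_cases hg : g = h <;>
    simp [hb, hg, eq_comm]

lemma freeCoords_ρ (g : G) (v : ι →₀ MonoidAlgebra ℤ G) (x : ι × G) :
    freeCoords G ι ((Rep.free ℤ G ι).ρ g v) x = freeCoords G ι v (x.1, g⁻¹ * x.2) := by
  suffices LinearMap.proj x ∘ₗ (freeCoords G ι).toLinearMap ∘ₗ (Rep.free ℤ G ι).ρ g =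
      LinearMap.proj (x.1, g⁻¹ * x.2) ∘ₗ (freeCoords G ι).toLinearMap from congr($this v)
  ext a h
  simp [freeCoords_single, Pi.single_apply, Prod.ext_iff, inv_mul_eq_iff_eq_mul]

lemma freeCoords_freeMap (c : ι → κ → G → ℤ) (v : ι →₀ MonoidAlgebra ℤ G) :
    freeCoords G κ ((freeMap c).hom v) = freeCoords G ι v ᵥ* freeMatrix c := by
  suffices (freeCoords G κ).toLinearMap ∘ₗ (freeMap c).hom.toLinearMap =
      (freeMatrix c).vecMulLinear ∘ₗ (freeCoords G ι).toLinearMap from congr($this v)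
  ext a g x
  have := freeCoords_ρ g ((freeCoords G κ).symm fun x => c a x.1 x.2) x
  simpa [freeCoords_single, freeMap, freeMatrix] using this

lemma hom_trivial_apply (φ : Rep.free ℤ G ι ⟶ Rep.trivial ℤ G ℤ) (v : ι →₀ MonoidAlgebra ℤ G) :
    φ.hom v = freeCoords G ι v ⬝ᵥ fun x => Rep.freeLiftLEquiv ℤ G ι (Rep.trivial ℤ G ℤ) φ x.1 := by
  obtain ⟨f, rfl⟩ : ∃ f, φ = Rep.freeLift ℤ G (Rep.trivial ℤ G ℤ) f :=
    ⟨_, ((Rep.freeLiftLEquiv ℤ G ι (Rep.trivial ℤ G ℤ)).symm_apply_apply φ).symm⟩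
  have hf : Rep.freeLiftLEquiv ℤ G ι (Rep.trivial ℤ G ℤ)
      (Rep.freeLift ℤ G (Rep.trivial ℤ G ℤ) f) = f :=
    (Rep.freeLiftLEquiv ℤ G ι (Rep.trivial ℤ G ℤ)).apply_symm_apply f
  rw [hf]
  suffices (Rep.freeLift ℤ G (Rep.trivial ℤ G ℤ) f).hom.toLinearMap =
      (dotProductBilin ℤ ℤ).flip (fun x : ι × G => f x.1) ∘ₗ (freeCoords G ι).toLinearMap from
    congr($this v)
  ext a g
  simp [freeCoords_single]

/-- The matrix induced by `freeMap c` on coinvariants. -/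
def augmentedMatrix (c : ι → κ → G → ℤ) : Matrix ι κ ℤ :=
  Matrix.of fun a b => ∑ g, c a b g

lemma freeLiftLEquiv_freeMap_comp (c : ι → κ → G → ℤ)
    (φ : Rep.free ℤ G κ ⟶ Rep.trivial ℤ G ℤ) :
    Rep.freeLiftLEquiv ℤ G ι (Rep.trivial ℤ G ℤ) (freeMap c ≫ φ) =
      augmentedMatrix c *ᵥ (Rep.freeLiftLEquiv ℤ G κ (Rep.trivial ℤ G ℤ) φ : κ → ℤ) := by
  ext a
  have h := hom_trivial_apply φ ((freeMap c).hom (Finsupp.single a (.single 1 1)))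
  rw [freeCoords_freeMap, freeCoords_single] at h
  refine h.trans ?_
  simp [dotProduct, mulVec, freeMatrix, augmentedMatrix, Fintype.sum_prod_type, Finset.sum_mul]

lemma freeMap_comp_freeMap {μ : Type} [Fintype μ] [DecidableEq μ] (c : ι → κ → G → ℤ)
    (d : κ → μ → G → ℤ) (h : freeMatrix c * freeMatrix d = 0) :
    freeMap c ≫ freeMap d = 0 := by
  refine Rep.free_ext ℤ G _ _ _ fun a => (freeCoords G μ).injective ?_
  have := freeCoords_freeMap d ((freeMap c).hom (Finsupp.single a (.single 1 1)))
  rw [freeCoords_freeMap c, vecMul_vecMul, h, vecMul_zero] at this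
  exact this.trans (map_zero (freeCoords G μ)).symm

omit [DecidableEq κ] in
lemma vecMul_vecMul_eq_self {A : Matrix ι κ ℤ} {B : Matrix κ ι ℤ} {f : ι → ℤ}
    (h : A * B + Matrix.of (fun _ y => f y) = 1) {v : ι → ℤ} (hv : ∑ x, v x = 0) :
    v ᵥ* A ᵥ* B = v := by
  conv_rhs => rw [← vecMul_one v, ← h, vecMul_add, ← vecMul_vecMul]
  rw [left_eq_add]
  ext y
  simp [vecMul, dotProduct, ← Finset.sum_mul, hv]

end FreeMaps

namespace Sigma3

/-- The symmetric group on three letters. -/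
abbrev G : Type := Equiv.Perm (Fin 3)

/-- The transposition of the first two letters. -/
def s : G := Equiv.swap 0 1

/-- The transposition of the last two letters. -/
def t : G := Equiv.swap 1 2

/-- The coordinates of a group element, as a basis vector of the group ring. -/
def δ (g : G) : G → ℤ := fun h => if h = g then 1 else 0

/-- The ranks of the terms of a 4-periodic free resolution of `ℤ` over `ℤ[Σ₃]`. -/
def rank : ℕ → ℕ
  | 0 => 1
  | 1 => 2
  | 2 => 2
  | 3 => 1
  | n + 4 => rank n

/-- The coordinates of the differentials of a 4-periodic free resolution of `ℤ` over `ℤ[Σ₃]`. -/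
def coeffs : (n : ℕ) → Fin (rank (n + 1)) → Fin (rank n) → G → ℤ
  | 0 => ![![δ s - δ 1], ![δ t - δ 1]]
  | 1 => ![![δ 1 + δ s, 0], ![δ 1 + δ (s * t) - δ t, δ s - δ 1 - δ (t * s)]]
  | 2 => ![![δ t - δ (t * s), δ 1 + δ s - δ (t * s) - δ (s * t * s)]]
  | 3 => ![![1]]
  | n + 4 => coeffs n

/-- The position of a permutation in lexicographic order. -/
def lexIndex (g : G) : ℕ := 2 * (g 0 : ℕ) + if g 1 < g 2 then 0 else 1

/-- The matrix with a given list of rows, the basis being ordered by `lexIndex` within each free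
summand. Missing entries are zero. -/
def tableMatrix {m n : ℕ} (l : List (List ℤ)) : Matrix (Fin m × G) (Fin n × G) ℤ :=
  Matrix.of fun x y => (l.getD (6 * x.1 + lexIndex x.2) []).getD (6 * y.1 + lexIndex y.2) 0

/-- The degree 0 part of a contracting homotopy of the augmented resolution. -/
def contraction₀ : Matrix (Fin 1 × G) (Fin 2 × G) ℤ := tableMatrix
  [[0, 0, 0, 0, 0, 0, 0, 0, 0, 0, 0, 0],
    [0, 0, 0, 0, 0, 0, 1, 0, 0, 0, 0, 0],
    [1, 0, 0, 0, 0, 0, 0, 0, 0, 0, 0, 0],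
    [1, 0, 0, 0, 0, 0, 0, 0, 1, 0, 0, 0],
    [0, 1, 0, 0, 0, 0, 1, 0, 0, 0, 0, 0],
    [1, 0, 0, 1, 0, 0, 0, 0, 1, 0, 0, 0]]

/-- The degree 1 part of a contracting homotopy of the augmented resolution. -/
def contraction₁ : Matrix (Fin 2 × G) (Fin 2 × G) ℤ := tableMatrix
  [[0, 0, 0, 0, 0, 0, 0, 0, 0, 0, 0, 0],
    [0, 0, 0, 0, 0, 0, 0, 0, 0, 0, 0, 0],
    [1, 0, 0, 0, 0, 0, 0, 0, 0, 0, 0, 0],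
    [0, 0, 0, 0, 0, 0, 0, 0, 0, 0, 0, 0],
    [0, 1, 0, 0, 0, 0, 0, 0, 0, 0, 0, 0],
    [0, 0, 0, 1, 0, 0, 0, 0, 0, 0, 0, 0],
    [0, 0, 0, 0, 0, 0, 0, 0, 0, 0, 0, 0],
    [0, 0, 0, 1, 0, 0, -1, -1, 0, 0, 0, 0],
    [0, 0, 0, 0, 0, 0, 0, 0, 0, 0, 0, 0],
    [0, 1, 0, 0, 0, 0, 0, 0, -1, -1, 0, 0],
    [0, 0, 0, 0, 0, 0, -1, 0, 0, 0, 0, 0],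
    [1, 0, 0, 0, 0, 0, 0, 0, -1, 0, 0, 0]]

/-- The degree 2 part of a contracting homotopy of the augmented resolution. -/
def contraction₂ : Matrix (Fin 2 × G) (Fin 1 × G) ℤ := tableMatrix
  [[0, 0, 0, 0, 0, 0],
    [0, 0, 0, 0, 0, 0],
    [0, 0, 1, 1, 1, 0],
    [0, 0, 0, 0, 0, 0],
    [-1, -1, 0, -1, 0, 0],
    [0, -1, -1, -1, 0, 0],
    [0, 0, 0, 0, 0, 0],
    [0, 0, 0, 0, 0, 0],
    [0, 0, 0, 0, 0, 0],
    [0, 0, 0, 0, 0, 0],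
    [-1, 0, 0, 0, 0, -1],
    [0, 0, -1, 0, -1, 0]]

/-- The degree 3 part of a contracting homotopy of the augmented resolution. -/
def contraction₃ : Matrix (Fin 1 × G) (Fin 1 × G) ℤ := tableMatrix
  [[-1], [1], [-1], [0], [1], [1]]

lemma freeMatrix_mul_zero : ∀ n, freeMatrix (coeffs (n + 1)) * freeMatrix (coeffs n) = 0
  | 0 => by decide +kernel
  | 1 => by decide +kernel
  | 2 => by decide +kernel
  | 3 => by decide +kernel
  | n + 4 => freeMatrix_mul_zero n

lemma exists_contraction : ∀ n,
    ∃ (S : Matrix (Fin (rank n) × G) (Fin (rank (n + 1)) × G) ℤ)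
      (T : Matrix (Fin (rank (n + 1)) × G) (Fin (rank (n + 2)) × G) ℤ),
      freeMatrix (coeffs n) * S + T * freeMatrix (coeffs (n + 1)) = 1
  | 0 => ⟨contraction₀, contraction₁, by decide +kernel⟩
  | 1 => ⟨contraction₁, contraction₂, by decide +kernel⟩
  | 2 => ⟨contraction₂, contraction₃, by decide +kernel⟩
  | 3 => ⟨tableMatrix [[1]], contraction₀, by decide +kernel⟩
  | n + 4 => exists_contraction n

lemma contraction₀_mul :
    contraction₀ * (freeMatrix (coeffs 0) : Matrix (Fin 2 × G) (Fin 1 × G) ℤ) +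
      Matrix.of (fun _ y => if y.2 = 1 then 1 else 0) = 1 := by
  decide +kernel

/-- A 4-periodic complex of free `ℤ[Σ₃]`-modules resolving `ℤ`. -/
noncomputable def complex : ChainComplex (Rep ℤ G) ℕ :=
  ChainComplex.of (fun n => Rep.free ℤ G (Fin (rank n))) (fun n => freeMap (coeffs n))
    fun n => freeMap_comp_freeMap _ _ (freeMatrix_mul_zero n)

lemma complex_d (n : ℕ) : complex.d (n + 1) n = freeMap (coeffs n) :=
  ChainComplex.of_d (fun n => Rep.free ℤ G (Fin (rank n))) (fun n => freeMap (coeffs n)) n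

/-- The augmentation `ℤ[Σ₃] ⟶ ℤ`. -/
noncomputable def augmentation : Rep.free ℤ G (Fin 1) ⟶ Rep.trivial ℤ G ℤ :=
  Rep.freeLift ℤ G (Rep.trivial ℤ G ℤ) fun _ => (1 : ℤ)

lemma augmentation_apply (v : Fin 1 →₀ MonoidAlgebra ℤ G) :
    augmentation.hom v = ∑ x, freeCoords G (Fin 1) v x := by
  rw [hom_trivial_apply]
  have : Rep.freeLiftLEquiv ℤ G (Fin 1) (Rep.trivial ℤ G ℤ) augmentation = fun _ => (1 : ℤ) :=
    (Rep.freeLiftLEquiv ℤ G (Fin 1) (Rep.trivial ℤ G ℤ)).apply_symm_apply fun _ => (1 : ℤ)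
  simp [this, dotProduct]

lemma d_comp_augmentation : complex.d 1 0 ≫ augmentation = 0 := by
  rw [complex_d]
  apply (Rep.freeLiftLEquiv ℤ G (Fin 2) (Rep.trivial ℤ G ℤ)).injective
  refine (freeLiftLEquiv_freeMap_comp (coeffs 0 : Fin 2 → Fin 1 → G → ℤ) augmentation).trans ?_
  have : augmentedMatrix (coeffs 0 : Fin 2 → Fin 1 → G → ℤ) = 0 := by decide +kernel
  rw [this, zero_mulVec]
  exact (map_zero (Rep.freeLiftLEquiv ℤ G (Fin 2) (Rep.trivial ℤ G ℤ))).symm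

lemma exact_succ (n : ℕ) (v : Fin (rank (n + 1)) →₀ MonoidAlgebra ℤ G)
    (hv : (freeMap (coeffs n)).hom v = 0) : ∃ w, (freeMap (coeffs (n + 1))).hom w = v := by
  obtain ⟨S, T, h⟩ := exists_contraction n
  refine ⟨(freeCoords G _).symm (freeCoords G _ v ᵥ* T), (freeCoords G _).injective ?_⟩
  have h0 := freeCoords_freeMap (coeffs n) v
  rw [hv, map_zero] at h0
  rw [freeCoords_freeMap, LinearEquiv.apply_symm_apply]
  conv_rhs => rw [← vecMul_one (freeCoords G _ v), ← h, vecMul_add, ← vecMul_vecMul, ← h0,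
    zero_vecMul, zero_add, ← vecMul_vecMul]

lemma exact_zero (v : Fin 1 →₀ MonoidAlgebra ℤ G) (hv : augmentation.hom v = 0) :
    ∃ w, (freeMap (coeffs 0)).hom w = v := by
  refine ⟨(freeCoords G (Fin 2)).symm (freeCoords G _ v ᵥ* contraction₀),
    (freeCoords G (Fin 1)).injective ?_⟩
  refine (freeCoords_freeMap (coeffs 0 : Fin 2 → Fin 1 → G → ℤ)
    ((freeCoords G (Fin 2)).symm (freeCoords G _ v ᵥ* contraction₀))).trans ?_
  refine (congrArg (· ᵥ* freeMatrix (coeffs 0 : Fin 2 → Fin 1 → G → ℤ))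
    ((freeCoords G (Fin 2)).apply_symm_apply _)).trans ?_
  rw [augmentation_apply] at hv
  exact vecMul_vecMul_eq_self contraction₀_mul hv

/-- The augmentation as a morphism of complexes. -/
noncomputable def augmentationMap :
    complex ⟶ (ChainComplex.single₀ (Rep ℤ G)).obj (Rep.trivial ℤ G ℤ) :=
  (complex.toSingle₀Equiv _).symm ⟨augmentation, d_comp_augmentation⟩

lemma augmentationMap_f_zero : augmentationMap.f 0 = augmentation :=
  ChainComplex.toSingle₀Equiv_symm_apply_f_zero (C := complex) augmentation d_comp_augmentation

instance : QuasiIso augmentationMap where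
  quasiIsoAt m := by
    cases m with
    | zero =>
      rw [ChainComplex.quasiIsoAt₀_iff,
        ShortComplex.quasiIso_iff_of_zeros' _ rfl rfl rfl]
      constructor
      · refine Rep.exact_of_forall_exists _ fun v hv => ?_
        obtain ⟨w, hw⟩ := exact_zero v (congr(($augmentationMap_f_zero).hom v).symm.trans hv)
        exact ⟨w, congr(($(complex_d 0)).hom w).trans hw⟩
      · rw [Rep.epi_iff_surjective]
        intro x
        refine ⟨(freeCoords G (Fin 1)).symm (Pi.single (0, 1) x),
          congr(($augmentationMap_f_zero).hom _).trans ?_⟩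
        rw [augmentation_apply, LinearEquiv.apply_symm_apply]
        exact Fintype.sum_pi_single' (0, 1) (x : ℤ)
    | succ m =>
      rw [quasiIsoAt_iff_exactAt' (hL := ChainComplex.exactAt_succ_single_obj ..),
          HomologicalComplex.exactAt_iff' _ (m + 2) (m + 1) m (by simp) (by simp)]
      refine Rep.exact_of_forall_exists _ fun v hv => ?_
      obtain ⟨w, hw⟩ := exact_succ m v (congr(($(complex_d m)).hom v).symm.trans hv)
      exact ⟨w, congr(($(complex_d (m + 1))).hom w).trans hw⟩

/-- A 4-periodic free resolution of the trivial `ℤ[Σ₃]`-module `ℤ`. -/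
noncomputable def resolution : ProjectiveResolution (Rep.trivial ℤ G ℤ) where
  complex := complex
  projective n := inferInstanceAs <| Projective (Rep.free ℤ G (Fin (rank n)))
  π := augmentationMap

/-- Equivariant maps from a free module of finite rank to `ℤ` are integral vectors. -/
noncomputable def cochainIso (n : ℕ) :
    (complex.linearYonedaObj ℤ (Rep.trivial ℤ G ℤ)).X n ≅
      ModuleCat.of ℤ (Fin (rank n) → ℤ) :=
  (Rep.freeLiftLEquiv ℤ G (Fin (rank n)) (Rep.trivial ℤ G ℤ)).toModuleIso

lemma cochainIso_comm (n : ℕ) :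
    (cochainIso n).hom ≫ ModuleCat.ofHom (augmentedMatrix (coeffs n)).mulVecLin =
      (complex.linearYonedaObj ℤ (Rep.trivial ℤ G ℤ)).d n (n + 1) ≫ (cochainIso (n + 1)).hom := by
  refine ModuleCat.hom_ext <| LinearMap.ext fun φ => ?_
  have := freeLiftLEquiv_freeMap_comp (coeffs n) φ
  rw [← complex_d] at this
  exact this.symm

lemma augmentedMatrix_mul_zero (n : ℕ) :
    augmentedMatrix (coeffs (n + 1)) * augmentedMatrix (coeffs n) = 0 :=
  match n with
  | 0 => by decide +kernel
  | 1 => by decide +kernel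
  | 2 => by decide +kernel
  | 3 => by decide +kernel
  | n + 4 => augmentedMatrix_mul_zero n

/-- The sequence whose homology computes `H^(n+1)`. -/
noncomputable def cochainSequence (n : ℕ) : ShortComplex (ModuleCat ℤ) :=
  ShortComplex.moduleCatMk (augmentedMatrix (coeffs n)).mulVecLin
    (augmentedMatrix (coeffs (n + 1))).mulVecLin <| by
      rw [← mulVecLin_mul, augmentedMatrix_mul_zero, mulVecLin_zero]

/-- The cohomology of `Σ₃` is the homology of `cochainSequence`. -/
noncomputable def groupCohomologyIsoHomology (n : ℕ) :
    groupCohomology (Rep.trivial ℤ G ℤ) (n + 1) ≅ (cochainSequence n).homology :=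
  groupCohomologyIso _ _ resolution ≪≫
    HomologicalComplex.homologyIsoSc' (complex.linearYonedaObj ℤ (Rep.trivial ℤ G ℤ))
      n (n + 1) (n + 2) (by simp) (by simp) ≪≫
    ShortComplex.homologyMapIso (ShortComplex.isoMk (cochainIso n) (cochainIso (n + 1))
      (cochainIso (n + 2)) (cochainIso_comm n) (cochainIso_comm (n + 1)))

lemma intCast_eq_zero_iff_exists (x : Fin 2 → ℤ) :
    (x 0 : ZMod 2) = 0 ↔ ∃ w : Fin 2 → ℤ, !![2, 0; 1, -1] *ᵥ w = x := by
  rw [ZMod.intCast_zmod_eq_zero_iff_dvd]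
  constructor
  · rintro ⟨c, hc⟩
    refine ⟨![c, c - x 1], funext fun i => ?_⟩
    fin_cases i
    · simpa [mulVec, dotProduct] using hc.symm
    · simp [mulVec, dotProduct]
  · rintro ⟨w, rfl⟩
    exact ⟨w 0, by simp [mulVec, dotProduct]⟩

lemma homology_cochainSequence (k : ℕ) :
    Nonempty ((cochainSequence (4 * k + 1)).homology ≃+ ZMod 2) :=
  match k with
  | k + 1 => homology_cochainSequence k
  | 0 => by
    have hf : augmentedMatrix (ι := Fin 2) (κ := Fin 2) (coeffs 1) = !![2, 0; 1, -1] := by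
      decide +kernel
    have hg : augmentedMatrix (coeffs 2 : Fin 1 → Fin 2 → G → ℤ) = 0 := by decide +kernel
    let φ : (Fin 2 → ℤ) →ₗ[ℤ] ZMod 2 :=
      (Int.castAddHom (ZMod 2)).toIntLinearMap ∘ₗ LinearMap.proj 0
    refine ⟨((cochainSequence 1).homologyEquivOfSurjective
      (φ ∘ₗ (LinearMap.ker (cochainSequence 1).g.hom).subtype) ?_ ?_).toAddEquiv⟩
    · intro y
      obtain ⟨a, rfl⟩ := ZMod.intCast_surjective y
      refine ⟨⟨![a, 0], ?_⟩, rfl⟩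
      exact (congrArg (· *ᵥ ![a, 0]) hg).trans (zero_mulVec _)
    · rintro ⟨x, hx⟩
      have h := intCast_eq_zero_iff_exists x
      rw [← hf] at h
      exact h.trans (exists_congr fun w => (Subtype.ext_iff
        (a1 := (cochainSequence 1).moduleCatToCycles w) (a2 := ⟨x, hx⟩)).symm)

end Sigma3

/-- For every natural number `n ≡ 2 (mod 4)`, the group cohomology `H^n(Σ₃; ℤ)` (with
trivial action on `ℤ`) is isomorphic to `ℤ/2ℤ`. -/
theorem groupCohomology_sigma3_two_mod_four (n : ℕ) (hn : n % 4 = 2) :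
    Nonempty ((groupCohomology (Rep.trivial ℤ (Equiv.Perm (Fin 3)) ℤ) n) ≃+ ZMod 2) := by
  obtain ⟨k, rfl⟩ : ∃ k, n = (4 * k + 1) + 1 := ⟨n / 4, by lia⟩
  obtain ⟨e⟩ := Sigma3.homology_cochainSequence k
  exact ⟨(Sigma3.groupCohomologyIsoHomology _).toLinearEquiv.toAddEquiv.trans e⟩
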